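/- arXiv:1007.1911 — 15 statements merged into one kernel-verified Lean document; each statement's English description precedes it below -/
import Mathlib

section
/- Let R be a series parallel interval order on a finite n-element set X and let λ1 and λ2 be two preorder linear extensions of R. If x, y ∈ X satisfy λ1(x) > λ1(y) and λ2(x) < λ2(y), then x and y are order equivalent in R. -/
/-- `x` and `y` are incomparable w.r.t. the relation `R`. -/
def Incomp {X : Type*} (R : X → X → Prop) (x y : X) : Prop :=
  ¬ R x y ∧ ¬ R y x

/-- The auxiliary relation `Z(R)`: `x Z y` iff `x` and `y` are `R`-incomparable and there
exists `z` which is `R`-comparable with `y` and `R`-incomparable with `x`. -/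
def Zrel {X : Type*} (R : X → X → Prop) (x y : X) : Prop :=
  Incomp R x y ∧ ∃ z, (R z y ∨ R y z) ∧ Incomp R z x

/-- `R` is (the strict order relation of) a series parallel interval order:
a strict partial order with no induced `2+2` and no induced fence of order four. -/
def IsSPIO {X : Type*} (R : X → X → Prop) : Prop :=
  (∀ x, ¬ R x x) ∧ (∀ x y z, R x y → R y z → R x z) ∧
  (¬ ∃ a b c d : X, a ≠ b ∧ a ≠ c ∧ a ≠ d ∧ b ≠ c ∧ b ≠ d ∧ c ≠ d ∧
      R a b ∧ R c d ∧ Incomp R a c ∧ Incomp R a d ∧ Incomp R b c ∧ Incomp R b d) ∧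
  (¬ ∃ a b c d : X, a ≠ b ∧ a ≠ c ∧ a ≠ d ∧ b ≠ c ∧ b ≠ d ∧ c ≠ d ∧
      R a b ∧ R c b ∧ R c d ∧ Incomp R a c ∧ Incomp R a d ∧ Incomp R b d)

/-- `lam` is a preorder linear extension of `R`: a bijective labelling by `Fin n`
compatible with both `R` and `Z(R)`. -/
def IsPLE {X : Type*} {n : ℕ} (R : X → X → Prop) (lam : X ≃ Fin n) : Prop :=
  (∀ x y, R x y → lam x < lam y) ∧ (∀ x y, Zrel R x y → lam x < lam y)

/-- `x` and `y` are order equivalent in `R`: some order automorphism maps `x` to `y`. -/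
def OrderEquivElems {X : Type*} (R : X → X → Prop) (x y : X) : Prop :=
  ∃ f : X ≃ X, (∀ a b, R a b ↔ R (f a) (f b)) ∧ f x = y

/-- Elements with the same strict predecessors and the same strict successors are order
equivalent: exchanging them is an automorphism. -/
theorem OrderEquivElems.of_forall_iff {X : Type*} {R : X → X → Prop} {x y : X}
    (hl : ∀ z, R z x ↔ R z y) (hr : ∀ z, R x z ↔ R y z) : OrderEquivElems R x y := by
  classical
  refine ⟨Equiv.swap x y, fun a b => ?_, Equiv.swap_apply_left x y⟩
  have swap_left : ∀ a b, R (Equiv.swap x y a) b ↔ R a b := by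
    intro a b
    by_cases ha : a = x
    · subst ha; rw [Equiv.swap_apply_left, hr]
    by_cases hb : a = y
    · subst hb; rw [Equiv.swap_apply_right, hr]
    · rw [Equiv.swap_apply_of_ne_of_ne ha hb]
  have swap_right : ∀ a b, R a (Equiv.swap x y b) ↔ R a b := by
    intro a b
    by_cases ha : b = x
    · subst ha; rw [Equiv.swap_apply_left, hl]
    by_cases hb : b = y
    · subst hb; rw [Equiv.swap_apply_right, hl]
    · rw [Equiv.swap_apply_of_ne_of_ne ha hb]
  rw [swap_left, swap_right]

/-- If `x` and `y` are incomparable and not related by `Z(R)`, then every strict predecessor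
(successor) of `y` is one of `x`. -/
theorem Incomp.of_not_zrel {X : Type*} {R : X → X → Prop}
    (htrans : ∀ x y z, R x y → R y z → R x z) {x y : X} (h : Incomp R x y)
    (hZ : ¬ Zrel R x y) (z : X) : (R z y → R z x) ∧ (R y z → R x z) := by
  have comparable : R z y ∨ R y z → R z x ∨ R x z := fun hz => by
    by_contra hzx
    exact hZ ⟨h, z, hz, not_or.mp hzx⟩
  exact ⟨fun hz => (comparable (.inl hz)).resolve_right fun hx => h.1 (htrans _ _ _ hx hz),
    fun hz => (comparable (.inr hz)).resolve_left fun hx => h.2 (htrans _ _ _ hz hx)⟩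

/-- If two preorder linear extensions of a series parallel interval order `R` disagree on
the relative order of `x` and `y`, then `x` and `y` are order equivalent in `R`. -/
theorem spio_ple_disagree_orderEquiv {X : Type*} {n : ℕ}
    (R : X → X → Prop) (hR : IsSPIO R)
    (lam1 lam2 : X ≃ Fin n) (h1 : IsPLE R lam1) (h2 : IsPLE R lam2)
    (x y : X) (hxy1 : lam1 y < lam1 x) (hxy2 : lam2 x < lam2 y) :
    OrderEquivElems R x y := by
  have hinc : Incomp R x y :=
    ⟨fun h => (h1.1 _ _ h).not_gt hxy1, fun h => (h2.1 _ _ h).not_gt hxy2⟩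
  have hyx := hinc.of_not_zrel hR.2.1 fun h => (h1.2 _ _ h).not_gt hxy1
  have hxy := Incomp.of_not_zrel hR.2.1 hinc.symm fun h => (h2.2 _ _ h).not_gt hxy2
  exact .of_forall_iff (fun z => ⟨(hxy z).1, (hyx z).1⟩) fun z => ⟨(hxy z).2, (hyx z).2⟩
end

section
/- Let R be a series parallel interval order on a finite n-element set X and let λ1 and λ2 be two preorder linear extensions of R. If x, y ∈ X satisfy λ1(x) = λ2(y), then x and y are order equivalent in R. (In particular, the preorder linear extension of R is unique up to order automorphisms of R.) -/
/-- `x` and `y` are twins: they have the same strict lower and strict upper bounds. -/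
def IsTwin {X : Type*} (R : X → X → Prop) (x y : X) : Prop :=
  ∀ z, (R z x ↔ R z y) ∧ (R x z ↔ R y z)

theorem IsTwin.symm {X : Type*} {R : X → X → Prop} {x y : X} (h : IsTwin R x y) :
    IsTwin R y x :=
  fun z => ⟨(h z).1.symm, (h z).2.symm⟩

/-- Two elements not related by `R` or `Zrel R` in either direction are twins. -/
theorem isTwin_of_not_related {X : Type*} {R : X → X → Prop}
    (htrans : ∀ x y z, R x y → R y z → R x z) {x y : X}
    (hxy : ¬ (R x y ∨ Zrel R x y)) (hyx : ¬ (R y x ∨ Zrel R y x)) : IsTwin R x y := by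
  intro z
  have t₁ := htrans x z y
  have t₂ := htrans y z x
  simp only [Zrel, Incomp, not_or, not_and, not_exists] at hxy hyx
  have h₁ := hxy.2 ⟨hxy.1, hyx.1⟩ z
  have h₂ := hyx.2 ⟨hyx.1, hxy.1⟩ z
  tauto

/-- `R ∪ Zrel R` is invariant under replacing its left argument by a twin. -/
theorem IsTwin.related_left {X : Type*} {R : X → X → Prop} {x y z : X} (h : IsTwin R z x)
    (hxy : R x y ∨ Zrel R x y) : R z y ∨ Zrel R z y := by
  rcases hxy with hxy | ⟨⟨h₁, h₂⟩, w, hw, h₃, h₄⟩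
  · exact Or.inl ((h y).2.mpr hxy)
  · refine Or.inr ⟨⟨?_, ?_⟩, w, hw, ?_, ?_⟩
    · rwa [(h y).2]
    · rwa [(h y).1]
    · rwa [(h w).1]
    · rwa [(h w).2]

/-- Interchanging two twins is an order automorphism. -/
theorem IsTwin.orderEquivElems {X : Type*} {R : X → X → Prop} {x y : X} (h : IsTwin R x y) :
    OrderEquivElems R x y := by
  classical
  have key (a z : X) : (R z (Equiv.swap x y a) ↔ R z a) ∧ (R (Equiv.swap x y a) z ↔ R a z) := by
    by_cases hx : a = x
    · subst hx
      simpa using h.symm z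
    by_cases hy : a = y
    · subst hy
      simpa using h z
    simp [Equiv.swap_apply_of_ne_of_ne hx hy]
  exact ⟨Equiv.swap x y, fun a b => by rw [(key a _).2, (key b _).1], Equiv.swap_apply_left x y⟩

theorem IsPLE.lt_of_related {X : Type*} {n : ℕ} {R : X → X → Prop} {lam : X ≃ Fin n}
    (h : IsPLE R lam) {x y : X} (hxy : R x y ∨ Zrel R x y) : lam x < lam y :=
  hxy.elim (h.1 x y) (h.2 x y)

/-- Elements at the same position of two preorder linear extensions are not related by
`R ∪ Zrel R`: otherwise the second extension would place the initial segment of the first one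
ending at `x` strictly below `y`. -/
theorem IsPLE.not_related_of_apply_eq {X : Type*} {n : ℕ} {R : X → X → Prop}
    (htrans : ∀ x y z, R x y → R y z → R x z) {lam1 lam2 : X ≃ Fin n}
    (h1 : IsPLE R lam1) (h2 : IsPLE R lam2) {x y : X} (hxy : lam1 x = lam2 y) :
    ¬ (R x y ∨ Zrel R x y) := by
  intro hrel
  have hmaps : ∀ i ∈ Finset.Iic (lam1 x), lam2 (lam1.symm i) ∈ Finset.Iio (lam1 x) := by
    intro i hi
    obtain ⟨z, rfl⟩ := lam1.surjective i
    rw [Finset.mem_Iic] at hi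
    rw [Equiv.symm_apply_apply, Finset.mem_Iio, hxy]
    by_cases hzx : R z x ∨ Zrel R z x
    · exact (h2.lt_of_related hzx).trans (h2.lt_of_related hrel)
    · have hxz : ¬ (R x z ∨ Zrel R x z) := fun h => (h1.lt_of_related h).not_ge hi
      exact h2.lt_of_related ((isTwin_of_not_related htrans hzx hxz).related_left hrel)
  have hcard := Finset.card_le_card_of_injOn _ hmaps
    (lam2.injective.comp lam1.symm.injective).injOn
  rw [Fin.card_Iic, Fin.card_Iio] at hcard
  omega

/-- If `λ₁(x) = λ₂(y)` for two preorder linear extensions `λ₁, λ₂` of a series parallel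
interval order `R`, then `x` and `y` are order equivalent in `R` (so the preorder linear
extension is unique up to order automorphisms). -/
theorem spio_ple_unique_up_to_automorphism {X : Type*} {n : ℕ}
    (R : X → X → Prop) (hR : IsSPIO R)
    (lam1 lam2 : X ≃ Fin n) (h1 : IsPLE R lam1) (h2 : IsPLE R lam2)
    (x y : X) (hxy : lam1 x = lam2 y) :
    OrderEquivElems R x y := by
  exact (isTwin_of_not_related hR.2.1 (h1.not_related_of_apply_eq hR.2.1 h2 hxy)
    (h2.not_related_of_apply_eq hR.2.1 h1 hxy.symm)).orderEquivElems
end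

section
/- Neither the poset 2+2 nor the fence of order four admits a preorder linear extension. Precisely: if R is the strict partial order on a four-element set {a,b,c,d} whose only relations are a R b and c R d (the poset 2+2), then there is no bijection λ from {a,b,c,d} to {1,2,3,4} with x R y implying λ(x) < λ(y) and x Z(R) y implying λ(x) < λ(y); and the same holds if R is the strict partial order whose only relations are a R b, c R b and c R d (the fence of order four). -/
/-- A preorder linear extension rules out pairs related by `Zrel R` in both directions. -/
theorem IsPLE.not_zrel_symm {X : Type*} {n : ℕ} {R : X → X → Prop} {lam : X ≃ Fin n}
    (h : IsPLE R lam) {x y : X} (hxy : Zrel R x y) : ¬ Zrel R y x :=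
  fun hyx => lt_asymm (h.2 x y hxy) (h.2 y x hyx)

/-- Neither the poset `2+2` nor the fence of order four admits a preorder linear
extension. -/
theorem no_ple_of_twoPlusTwo_and_fence {X : Type*} (a b c d : X)
    (hab : a ≠ b) (hac : a ≠ c) (had : a ≠ d) (hbc : b ≠ c) (hbd : b ≠ d) (hcd : c ≠ d)
    (R1 R2 : X → X → Prop)
    (hR1 : ∀ x y, R1 x y ↔ (x = a ∧ y = b) ∨ (x = c ∧ y = d))
    (hR2 : ∀ x y, R2 x y ↔ (x = a ∧ y = b) ∨ (x = c ∧ y = b) ∨ (x = c ∧ y = d)) :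
    (¬ ∃ lam : X ≃ Fin 4, IsPLE R1 lam) ∧ (¬ ∃ lam : X ≃ Fin 4, IsPLE R2 lam) := by
  constructor
  · rintro ⟨lam, h⟩
    have hac' : Zrel R1 a c := by
      refine ⟨?_, d, ?_, ?_⟩ <;> simp only [Incomp, hR1] <;> grind
    have hca' : Zrel R1 c a := by
      refine ⟨?_, b, ?_, ?_⟩ <;> simp only [Incomp, hR1] <;> grind
    exact h.not_zrel_symm hac' hca'
  · rintro ⟨lam, h⟩
    have had' : Zrel R2 a d := by
      refine ⟨?_, c, ?_, ?_⟩ <;> simp only [Incomp, hR2] <;> grind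
    have hda' : Zrel R2 d a := by
      refine ⟨?_, b, ?_, ?_⟩ <;> simp only [Incomp, hR2] <;> grind
    exact h.not_zrel_symm had' hda'
end

section
/- Let R be a preorder-labelled series parallel interval order on {1,...,n}. Then for every k ∈ {1,...,n}, the principal filter R(k) = {y : k R y} is a final segment of {1,...,n}: if y ∈ R(k) and y < z ≤ n, then z ∈ R(k). Consequently, for two preorder-labelled series parallel interval orders R1, R2 on {1,...,n} and any k, one has |R1(k)| ≥ |R2(k)| if and only if R1(k) ⊇ R2(k). -/
/-- `R` is a preorder-labelled series parallel interval order on `Fin n`: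
the identity labelling is its preorder linear extension. -/
def PLSPIO {n : ℕ} (R : Fin n → Fin n → Prop) : Prop :=
  IsSPIO R ∧ (∀ x y, R x y → x < y) ∧ (∀ x y, Zrel R x y → x < y)

/-- The principal filter `R(k) = {y : k R y}` (without its minimum). -/
def filt {n : ℕ} (R : Fin n → Fin n → Prop) (k : Fin n) : Set (Fin n) :=
  {y | R k y}

/-- The principal ideal `R⁻¹(k) = {y : y R k}` (without its maximum). -/
def idl {n : ℕ} (R : Fin n → Fin n → Prop) (k : Fin n) : Set (Fin n) :=
  {y | R y k}

/-- Principal filters of a preorder-labelled series parallel interval order are final segments. -/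
theorem PLSPIO.isUpperSet_filt {n : ℕ} {R : Fin n → Fin n → Prop} (hR : PLSPIO R) (k : Fin n) :
    IsUpperSet (filt R k) := by
  obtain ⟨⟨-, htrans, -⟩, hlt, hZ⟩ := hR
  intro y z hyz (hky : R k y)
  obtain rfl | hyz := hyz.eq_or_lt
  · exact hky
  by_contra hkz
  change ¬ R k z at hkz
  have hzk : ¬ R z k := fun h => lt_asymm ((hlt k y hky).trans hyz) (hlt z k h)
  have hzy : ¬ R z y := fun h => lt_asymm hyz (hlt z y h)
  have hyz' : ¬ R y z := fun h => hkz (htrans k y z hky h)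
  exact lt_asymm hyz (hZ z y ⟨⟨hzy, hyz'⟩, k, Or.inl hky, hkz, hzk⟩)

/-- Finite upper sets of a linear order are compared by inclusion according to cardinality. -/
theorem IsUpperSet.ncard_le_ncard_iff_subset {α : Type*} [LinearOrder α] {s t : Set α}
    (hs : IsUpperSet s) (ht : IsUpperSet t) (hsf : s.Finite) (htf : t.Finite) :
    s.ncard ≤ t.ncard ↔ s ⊆ t := by
  refine ⟨fun h => ?_, fun h => Set.ncard_le_ncard h htf⟩
  obtain hst | hts := hs.total ht
  · exact hst
  · exact (Set.eq_of_subset_of_ncard_le hts h hsf).superset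

/-- For a preorder-labelled series parallel interval order, every principal filter is a
final segment of `{1,...,n}`; consequently, comparison of filter cardinalities is
equivalent to filter containment. -/
theorem filt_final_segment_and_card_iff_subset {n : ℕ}
    (R : Fin n → Fin n → Prop) (hR : PLSPIO R) :
    (∀ k y z : Fin n, y ∈ filt R k → y < z → z ∈ filt R k) ∧
    (∀ R1 R2 : Fin n → Fin n → Prop, PLSPIO R1 → PLSPIO R2 → ∀ k : Fin n,
      ((filt R2 k).ncard ≤ (filt R1 k).ncard ↔ filt R2 k ⊆ filt R1 k)) := by
  refine ⟨fun k y z hy hyz => hR.isUpperSet_filt k hyz.le hy, fun R1 R2 h1 h2 k => ?_⟩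
  exact (h2.isUpperSet_filt k).ncard_le_ncard_iff_subset (h1.isUpperSet_filt k)
    (Set.toFinite _) (Set.toFinite _)
end

section
/- Let R be a preorder-labelled series parallel interval order on {1,...,n}. Then the relation ≺ on {1,...,n} defined by k ≺ j iff R(k) ⊋ R(j), or R(k) = R(j) and k > j, is a strict linear order; moreover, the permutation π(R) of {1,...,n} obtained by listing the elements of {1,...,n} in ≺-increasing order avoids the pattern 312. -/
/-- `a` precedes `b` in the one-line notation of the permutation `π`. -/
def Precedes {n : ℕ} (π : Equiv.Perm (Fin n)) (a b : Fin n) : Prop :=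
  π.symm a < π.symm b

/-- `π` avoids the pattern 312. -/
def Avoids312 {n : ℕ} (π : Equiv.Perm (Fin n)) : Prop :=
  ¬ ∃ i j k : Fin n, i < j ∧ j < k ∧ π j < π k ∧ π k < π i
/-- The linear order on labels used to build the permutation `π(R)`:
`k ≺ j` iff `R(k) ⊋ R(j)`, or `R(k) = R(j)` and `k > j`. -/
def precRel {n : ℕ} (R : Fin n → Fin n → Prop) (k j : Fin n) : Prop :=
  filt R j ⊂ filt R k ∨ (filt R k = filt R j ∧ j < k)

/-- `π` is the permutation `π(R)` associated with `R`: `k` precedes `j` in `π`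
exactly when `k ≺ j`. -/
def IsPiOf {n : ℕ} (R : Fin n → Fin n → Prop) (π : Equiv.Perm (Fin n)) : Prop :=
  ∀ k j : Fin n, k ≠ j → (Precedes π k j ↔ precRel R k j)

/-- In a series parallel interval order any two principal filters are comparable by inclusion. -/
theorem IsSPIO.filt_subset_or_subset {n : ℕ} {R : Fin n → Fin n → Prop} (hR : IsSPIO R)
    (k j : Fin n) : filt R k ⊆ filt R j ∨ filt R j ⊆ filt R k := by
  obtain ⟨hirr, htr, h22, -⟩ := hR
  by_contra! h
  obtain ⟨b, hkb, hjb⟩ := Set.not_subset.1 h.1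
  obtain ⟨d, hjd, hkd⟩ := Set.not_subset.1 h.2
  simp only [filt, Set.mem_ofPred_eq] at hkb hjb hjd hkd
  refine h22 ⟨k, b, j, d, ?_, ?_, ?_, ?_, ?_, ?_, hkb, hjd, ⟨?_, ?_⟩, ⟨?_, ?_⟩, ⟨?_, ?_⟩,
    ⟨?_, ?_⟩⟩ <;> grind

theorem precRel_irrefl {n : ℕ} (R : Fin n → Fin n → Prop) (k : Fin n) : ¬ precRel R k k := by
  rintro (h | h)
  exacts [ssubset_irrefl _ h, lt_irrefl _ h.2]

theorem precRel.trans {n : ℕ} {R : Fin n → Fin n → Prop} {k j l : Fin n} (hkj : precRel R k j)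
    (hjl : precRel R j l) : precRel R k l := by
  rcases hkj with h | ⟨h, hlt⟩ <;> rcases hjl with h' | ⟨h', hlt'⟩
  · exact .inl (h'.trans h)
  · exact .inl (h' ▸ h)
  · exact .inl (h ▸ h')
  · exact .inr ⟨h.trans h', hlt'.trans hlt⟩

theorem IsSPIO.precRel_total {n : ℕ} {R : Fin n → Fin n → Prop} (hR : IsSPIO R) {k j : Fin n}
    (hkj : k ≠ j) : precRel R k j ∨ precRel R j k := by
  by_cases he : filt R k = filt R j
  · exact hkj.lt_or_gt.elim (fun h => .inr (.inr ⟨he.symm, h⟩)) fun h => .inl (.inr ⟨he, h⟩)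
  · exact (hR.filt_subset_or_subset k j).elim
      (fun h => .inr (.inl (h.ssubset_of_ne he)))
      fun h => .inl (.inl (h.ssubset_of_ne (Ne.symm he)))

/-- No three labels `a < b < c` satisfy `c ≺ a ≺ b`. -/
theorem PLSPIO.not_precRel_312 {n : ℕ} {R : Fin n → Fin n → Prop} (hR : PLSPIO R)
    {a b c : Fin n} (hab : a < b) (hbc : b < c) (hca : precRel R c a) : ¬ precRel R a b := by
  rintro (hss | ⟨-, hlt⟩)
  swap
  · exact hlt.not_gt hab
  obtain ⟨⟨hirr, htr, -⟩, hlab, hZ⟩ := hR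
  have hsub : filt R a ⊆ filt R c := hca.elim (fun h => h.subset) fun h => h.1.ge
  obtain ⟨z, haz, hbz⟩ := Set.exists_of_ssubset hss
  have hcz : R c z := hsub haz
  have hzb : ¬ R z b := fun h => (hlab _ _ (htr _ _ _ hcz h)).not_gt hbc
  have hba : ¬ R b a := fun h => (hlab _ _ h).not_gt hab
  have hcb : ¬ R c b := fun h => (hlab _ _ h).not_gt hbc
  have hca' : ¬ R c a := fun h => (hlab _ _ h).not_gt (hab.trans hbc)
  have hbc' : ¬ R b c := fun h => hbz (htr _ _ _ h hcz)
  have hRab : R a b := by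
    by_contra h
    exact (hZ b a ⟨⟨hba, h⟩, z, .inr haz, hzb, hbz⟩).not_gt hab
  have hac : R a c := by
    by_contra h
    exact (hZ c b ⟨⟨hcb, hbc'⟩, a, .inl hRab, h, hca'⟩).not_gt hbc
  exact hirr c (hsub hac)

/-- For a preorder-labelled series parallel interval order `R`, the relation
`k ≺ j ↔ R(k) ⊋ R(j) ∨ (R(k) = R(j) ∧ k > j)` is a strict linear order, and the
permutation `π(R)` listing `{1,...,n}` in `≺`-increasing order avoids the pattern 312. -/
theorem precRel_linear_and_piOf_avoids312 {n : ℕ}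
    (R : Fin n → Fin n → Prop) (hR : PLSPIO R) :
    (∀ k, ¬ precRel R k k) ∧
    (∀ k j l, precRel R k j → precRel R j l → precRel R k l) ∧
    (∀ k j, k ≠ j → precRel R k j ∨ precRel R j k) ∧
    (∀ π : Equiv.Perm (Fin n), IsPiOf R π → Avoids312 π) := by
  refine ⟨precRel_irrefl R, fun _ _ _ => precRel.trans, fun _ _ => hR.1.precRel_total, ?_⟩
  rintro π hπ ⟨i, j, k, hij, hjk, hlt, hlt'⟩
  have hprec : ∀ {i j : Fin n}, i < j → precRel R (π i) (π j) := fun {i j} h =>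
    (hπ _ _ (π.injective.ne h.ne)).1 (by simpa [Precedes] using h)
  exact hR.not_precRel_312 hlt hlt' (hprec hij) (hprec hjk)
end

section
/- The map R ↦ π(R) is a bijection from the set of preorder-labelled series parallel interval orders on {1,...,n} onto the set Av_n(312) of 312-avoiding permutations of {1,...,n}. -/
section

variable {n : ℕ} {R : Fin n → Fin n → Prop} {π : Equiv.Perm (Fin n)}

/-- In an interval order the principal filters form a chain under inclusion. -/
theorem PLSPIO.filt_total (hR : PLSPIO R) (a c : Fin n) :
    filt R a ⊆ filt R c ∨ filt R c ⊆ filt R a := by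
  obtain ⟨⟨hirr, htr, h22, -⟩, -, -⟩ := hR
  by_contra! h
  obtain ⟨⟨b, hab, hcb⟩, ⟨d, hcd, had⟩⟩ := Set.not_subset.1 h.1, Set.not_subset.1 h.2
  simp only [filt, Set.mem_ofPred_eq] at hab hcb hcd had
  refine h22 ⟨a, b, c, d, ?_, ?_, ?_, ?_, ?_, ?_, hab, hcd, ⟨?_, ?_⟩, ⟨?_, ?_⟩, ⟨?_, ?_⟩,
    ⟨?_, ?_⟩⟩ <;> grind

/-- A sort key whose order is `precRel R`. -/
noncomputable def sortKey (R : Fin n → Fin n → Prop) (k : Fin n) : ℕᵒᵈ ×ₗ (Fin n)ᵒᵈ :=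
  toLex (OrderDual.toDual (filt R k).ncard, OrderDual.toDual k)

theorem sortKey_injective : Function.Injective (sortKey R) := by
  intro a b h
  simpa [sortKey] using congrArg (fun x => OrderDual.ofDual (ofLex x).2) h

theorem PLSPIO.sortKey_lt_iff (hR : PLSPIO R) (k j : Fin n) :
    sortKey R k < sortKey R j ↔ precRel R k j := by
  have hcard : (filt R j).ncard < (filt R k).ncard ↔ filt R j ⊂ filt R k := by
    refine ⟨fun h => ?_, fun h => Set.ncard_lt_ncard h⟩
    rcases hR.filt_total j k with hs | hs
    · exact hs.ssubset_of_ne (fun he => by simp [he] at h)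
    · exact absurd (Set.ncard_le_ncard hs) (not_le.2 h)
  have heq : (filt R k).ncard = (filt R j).ncard ↔ filt R k = filt R j := by
    refine ⟨fun h => ?_, fun h => by rw [h]⟩
    rcases hR.filt_total k j with hs | hs
    · exact Set.eq_of_subset_of_ncard_le hs h.ge
    · exact (Set.eq_of_subset_of_ncard_le hs h.le).symm
  simp [sortKey, Prod.Lex.toLex_lt_toLex, precRel, hcard, heq]

theorem PLSPIO.isPiOf_iff_strictMono (hR : PLSPIO R) :
    IsPiOf R π ↔ StrictMono (sortKey R ∘ π) := by
  simp only [IsPiOf, Precedes, ← hR.sortKey_lt_iff]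
  constructor
  · intro h i j hij
    exact (h (π i) (π j) (π.injective.ne hij.ne)).1 (by simpa using hij)
  · intro h k j _
    simpa using (h.lt_iff_lt (a := π.symm k) (b := π.symm j)).symm

theorem PLSPIO.existsUnique_isPiOf (hR : PLSPIO R) :
    ∃! π : Equiv.Perm (Fin n), IsPiOf R π := by
  simp only [hR.isPiOf_iff_strictMono]
  refine ⟨Tuple.sort (sortKey R), (Tuple.monotone_sort _).strictMono_of_injective
    (sortKey_injective.comp (Equiv.injective _)), fun σ hσ => ?_⟩
  have h := (StrictMono.range_inj hσ ((Tuple.monotone_sort (sortKey R)).strictMono_of_injective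
    (sortKey_injective.comp (Equiv.injective _)))).1 (by simp [Set.range_comp])
  exact Equiv.ext fun i => sortKey_injective (congrFun h i)

/-- `R` is recovered from `π(R)` as the intersection of the usual order with the order of
occurrence in `π(R)`. -/
theorem PLSPIO.rel_iff (hR : PLSPIO R) (hπ : IsPiOf R π) (x y : Fin n) :
    R x y ↔ x < y ∧ Precedes π x y := by
  obtain ⟨⟨hirr, htr, -, -⟩, hlt, hZ⟩ := hR
  constructor
  · intro h
    refine ⟨hlt x y h, (hπ x y (hlt x y h).ne).2 (Or.inl ⟨fun z => htr x y z h, fun hs => ?_⟩)⟩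
    exact hirr y (hs h)
  · rintro ⟨hxy, hp⟩
    rcases (hπ x y hxy.ne).1 hp with hs | ⟨-, hyx⟩
    · obtain ⟨z, hxz, hyz⟩ := Set.not_subset.1 hs.2
      by_contra hn
      refine lt_asymm hxy (hZ y x ⟨⟨fun h => lt_asymm hxy (hlt y x h), hn⟩, z, Or.inr hxz,
        fun h => hn (htr x z y hxz h), hyz⟩)
    · exact absurd hyx (lt_asymm hxy)

theorem PLSPIO.avoids312 (hR : PLSPIO R) (hπ : IsPiOf R π) : Avoids312 π := by
  rintro ⟨i, j, k, hij, hjk, hjk', hki⟩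
  have hab : R (π j) (π k) := (hR.rel_iff hπ _ _).2 ⟨hjk', by simpa [Precedes] using hjk⟩
  have hs : filt R (π j) ⊆ filt R (π i) := by
    rcases (hπ (π i) (π j) (π.injective.ne hij.ne)).1 (by simpa [Precedes] using hij) with h | h
    · exact h.subset
    · exact h.1.ge
  exact lt_asymm hki (hR.2.1 _ _ (hs hab))

/-- The intersection of the usual order with the order of occurrence in `π`. -/
def interRel (π : Equiv.Perm (Fin n)) (x y : Fin n) : Prop :=
  x < y ∧ Precedes π x y

theorem Avoids312.lt_of_precedes (hπ : Avoids312 π) {a b c : Fin n} (hca : Precedes π c a)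
    (hab : Precedes π a b) (h : a < b) : c < b := by
  by_contra! hbc
  rcases hbc.lt_or_eq with hbc | rfl
  · exact hπ ⟨π.symm c, π.symm a, π.symm b, hca, hab, by simpa using h, by simpa using hbc⟩
  · exact lt_asymm hca hab

theorem precedes_total {a b : Fin n} (h : a ≠ b) : Precedes π a b ∨ Precedes π b a :=
  lt_or_gt_of_ne (π.symm.injective.ne h)

theorem Avoids312.plspio_interRel (hπ : Avoids312 π) : PLSPIO (interRel π) := by
  have key := @hπ.lt_of_precedes
  have tot := @precedes_total n π
  have tr : ∀ {a b c}, Precedes π a b → Precedes π b c → Precedes π a c := lt_trans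
  have asym : ∀ {a b}, Precedes π a b → ¬ Precedes π b a := lt_asymm
  refine ⟨⟨fun x h => lt_irrefl x h.1, fun x y z h h' => ⟨h.1.trans h'.1, tr h.2 h'.2⟩,
    ?_, ?_⟩, fun x y h => h.1, ?_⟩
  · rintro ⟨a, b, c, d, -, hac, -, hbc, -, -, hab, hcd, iac, iad, ibc, ibd⟩
    simp only [Incomp, interRel] at *
    grind
  · rintro ⟨a, b, c, d, -, hac, had, -, hbd, -, hab, hcb, hcd, iac, iad, ibd⟩
    simp only [Incomp, interRel] at *
    grind
  · rintro x y ⟨ixy, z, hzy, izx⟩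
    have hxy : x ≠ y := by rintro rfl; exact hzy.elim izx.1 izx.2
    have hzx : z ≠ x := by rintro rfl; exact hzy.elim ixy.1 ixy.2
    simp only [Incomp, interRel] at *
    grind

theorem Avoids312.precRel_interRel (hπ : Avoids312 π) {k j : Fin n} (h : Precedes π k j) :
    precRel (interRel π) k j := by
  have hkj : k ≠ j := by rintro rfl; exact lt_irrefl _ h
  have hs : filt (interRel π) j ⊆ filt (interRel π) k := fun z hz =>
    ⟨hπ.lt_of_precedes h hz.2 hz.1, lt_trans h hz.2⟩
  rcases hs.ssubset_or_eq with h' | h'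
  · exact Or.inl h'
  · refine Or.inr ⟨h'.symm, (lt_or_gt_of_ne hkj).resolve_left fun hlt => ?_⟩
    have hmem : j ∈ filt (interRel π) j := h' ▸ ⟨hlt, h⟩
    exact lt_irrefl j hmem.1

theorem Avoids312.isPiOf_interRel (hπ : Avoids312 π) : IsPiOf (interRel π) π := by
  refine fun k j hkj => ⟨hπ.precRel_interRel, fun h => ?_⟩
  refine (precedes_total hkj).resolve_right fun h' => ?_
  rw [← hπ.plspio_interRel.sortKey_lt_iff] at h
  exact lt_asymm h ((hπ.plspio_interRel.sortKey_lt_iff _ _).2 (hπ.precRel_interRel h'))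

end

/-- The map `R ↦ π(R)` is a bijection from the preorder-labelled series parallel
interval orders on `{1,...,n}` onto the 312-avoiding permutations of `{1,...,n}`:
`π(R)` exists and is unique, avoids 312, the map is injective, and every 312-avoiding
permutation arises this way. -/
theorem piOf_bijection {n : ℕ} :
    (∀ R : Fin n → Fin n → Prop, PLSPIO R → ∃! π : Equiv.Perm (Fin n), IsPiOf R π) ∧
    (∀ (R : Fin n → Fin n → Prop) (π : Equiv.Perm (Fin n)),
      PLSPIO R → IsPiOf R π → Avoids312 π) ∧
    (∀ (R1 R2 : Fin n → Fin n → Prop) (π : Equiv.Perm (Fin n)),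
      PLSPIO R1 → PLSPIO R2 → IsPiOf R1 π → IsPiOf R2 π → R1 = R2) ∧
    (∀ π : Equiv.Perm (Fin n), Avoids312 π →
      ∃ R : Fin n → Fin n → Prop, PLSPIO R ∧ IsPiOf R π) := by
  refine ⟨fun R hR => hR.existsUnique_isPiOf, fun R π hR hπ => hR.avoids312 hπ,
    fun R₁ R₂ π h₁ h₂ hπ₁ hπ₂ => ?_,
    fun π hπ => ⟨interRel π, hπ.plspio_interRel, hπ.isPiOf_interRel⟩⟩
  ext x y
  rw [h₁.rel_iff hπ₁, h₂.rel_iff hπ₂]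
end

section
/- Let R be a preorder-labelled series parallel interval order on {1,...,n} and let π = π(R). Then for every k ∈ {1,...,n}: f_π(k) = R(k) (the elements of π greater than k and following k in π are exactly the elements of the principal filter of k) and i_π(k) = R⁻¹(k) (the elements of π less than k and preceding k in π are exactly the elements of the principal ideal of k). -/
/-- `i_π(k)`: the elements of `π` less than `k` and preceding `k` in `π`. -/
def iset {n : ℕ} (π : Equiv.Perm (Fin n)) (k : Fin n) : Set (Fin n) :=
  {m | m < k ∧ Precedes π m k}

/-- `f_π(k)`: the elements of `π` greater than `k` and following `k` in `π`. -/
def fset {n : ℕ} (π : Equiv.Perm (Fin n)) (k : Fin n) : Set (Fin n) :=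
  {m | k < m ∧ Precedes π k m}

/-- For labels in increasing order, preceding in `π(R)` is the same as being `R`-related. -/
theorem PLSPIO.precRel_iff {n : ℕ} {R : Fin n → Fin n → Prop} (hR : PLSPIO R)
    {k m : Fin n} (hkm : k < m) : precRel R k m ↔ R k m := by
  obtain ⟨⟨irrefl, trans, -, -⟩, lt_of_R, lt_of_Z⟩ := hR
  constructor
  · rintro (h | ⟨-, h⟩)
    · by_contra hn
      obtain ⟨z, hkz, hmz⟩ := Set.exists_of_ssubset h
      have hmk : ¬ R m k := fun h' => hkm.asymm (lt_of_R _ _ h')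
      exact hkm.asymm (lt_of_Z m k
        ⟨⟨hmk, hn⟩, z, Or.inr hkz, fun hzm => hn (trans _ _ _ hkz hzm), hmz⟩)
    · exact absurd h hkm.asymm
  · intro h
    exact Or.inl ((Set.ssubset_iff_of_subset fun y hy => trans _ _ _ h hy).2 ⟨m, h, irrefl m⟩)

/-- For a preorder-labelled series parallel interval order `R` and `π = π(R)`,
the set `f_π(k)` coincides with the principal filter `R(k)` and the set `i_π(k)`
coincides with the principal ideal `R⁻¹(k)`. -/
theorem fset_eq_filt_and_iset_eq_idl {n : ℕ}
    (R : Fin n → Fin n → Prop) (hR : PLSPIO R)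
    (π : Equiv.Perm (Fin n)) (hπ : IsPiOf R π) :
    ∀ k : Fin n, fset π k = filt R k ∧ iset π k = idl R k := by
  have key : ∀ {a b : Fin n}, (a < b ∧ Precedes π a b) ↔ R a b := fun {a b} =>
    ⟨fun ⟨hab, h⟩ => (hR.precRel_iff hab).1 ((hπ a b hab.ne).1 h), fun h =>
      have hab := hR.2.1 a b h
      ⟨hab, (hπ a b hab.ne).2 ((hR.precRel_iff hab).2 h)⟩⟩
  exact fun k => ⟨Set.ext fun _ => key, Set.ext fun _ => key⟩
end

section
/- The Tamari order is isomorphic to the weak Bruhat order restricted to Av_n(312): for any two preorder-labelled series parallel interval orders R1, R2 on {1,...,n}, one has π(R1) ≤_b π(R2) in the weak Bruhat order if and only if R1 ≤_T R2 in the Tamari order (i.e. R1(k) ⊇ R2(k) for every k). -/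
/-- One permutation is a simple reduction of another: it is obtained by interchanging
two adjacent entries that form a descent. -/
def SimpleRedStep {n : ℕ} (σ τ : Equiv.Perm (Fin n)) : Prop :=
  ∃ i j : Fin n, (j : ℕ) = (i : ℕ) + 1 ∧ σ j < σ i ∧ τ = σ * Equiv.swap i j

/-- The weak Bruhat order: `π1 ≤_b π2` iff `π1` is obtained from `π2` by a finite
sequence of simple reductions. -/
def WeakBruhatLe {n : ℕ} (π1 π2 : Equiv.Perm (Fin n)) : Prop :=
  Relation.ReflTransGen SimpleRedStep π2 π1

/-- The inversions of `π`: pairs of values `a < b` such that `b` precedes `a`. -/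
def inversions {n : ℕ} (π : Equiv.Perm (Fin n)) : Set (Fin n × Fin n) :=
  {p | p.1 < p.2 ∧ Precedes π p.2 p.1}

theorem swap_adjacent_lt_iff {n : ℕ} {i j : Fin n} (hij : (j : ℕ) = (i : ℕ) + 1) (p q : Fin n) :
    Equiv.swap i j p < Equiv.swap i j q ↔ (p < q ∧ ¬ (p = i ∧ q = j)) ∨ (p = j ∧ q = i) := by
  simp only [Equiv.swap_apply_def]
  split_ifs <;> simp only [Fin.lt_def, Fin.ext_iff] at * <;> omega

theorem inversions_ssubset_of_simpleRedStep {n : ℕ} {σ τ : Equiv.Perm (Fin n)}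
    (h : SimpleRedStep σ τ) : inversions τ ⊂ inversions σ := by
  obtain ⟨i, j, hij, hlt, rfl⟩ := h
  have key (x y : Fin n) : Precedes (σ * Equiv.swap i j) x y ↔
      (Precedes σ x y ∧ ¬ (x = σ i ∧ y = σ j)) ∨ (x = σ j ∧ y = σ i) := by
    have := swap_adjacent_lt_iff hij (σ.symm x) (σ.symm y)
    simp only [Equiv.symm_apply_eq] at this
    exact this
  refine ⟨?_, fun hsub => ?_⟩
  · rintro ⟨a, b⟩ ⟨hab, hp⟩
    refine ⟨hab, ?_⟩
    rcases (key b a).1 hp with h | ⟨rfl, rfl⟩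
    · exact h.1
    · exact absurd hab hlt.asymm
  · have hmem : (σ j, σ i) ∈ inversions σ :=
      ⟨hlt, by simp only [Precedes, Equiv.symm_apply_apply, Fin.lt_def]; omega⟩
    rcases (key (σ i) (σ j)).1 (hsub hmem).2 with h | h
    · exact h.2 ⟨rfl, rfl⟩
    · exact hlt.ne h.1.symm

theorem perm_eq_one_of_lt_adjacent {n : ℕ} (ρ : Equiv.Perm (Fin n))
    (h : ∀ i j : Fin n, (j : ℕ) = (i : ℕ) + 1 → ρ i < ρ j) : ρ = 1 := by
  cases n with
  | zero => exact Subsingleton.elim _ _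
  | succ m =>
    have hmono : StrictMono ρ := Fin.strictMono_iff_lt_succ.2 fun i => h _ _ (by simp)
    have : (ρ : Fin (m + 1) → Fin (m + 1)) = id :=
      (hmono.range_inj strictMono_id).1 (by simp [ρ.surjective.range_eq])
    ext x
    simp [this]

/-- Unless `π = σ`, some simple reduction of `σ` still has all inversions of `π`. -/
theorem exists_simpleRedStep {n : ℕ} {π σ : Equiv.Perm (Fin n)}
    (hsub : inversions π ⊆ inversions σ) (hne : π ≠ σ) :
    ∃ τ, SimpleRedStep σ τ ∧ inversions π ⊆ inversions τ := by
  by_contra! hno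
  refine hne ?_
  have hone : π⁻¹ * σ = 1 := by
    refine perm_eq_one_of_lt_adjacent _ fun i j hij => ?_
    change Precedes π (σ i) (σ j)
    have hne' : σ i ≠ σ j := fun h => by have := congrArg Fin.val (σ.injective h); omega
    by_contra hnot
    have hji : Precedes π (σ j) (σ i) :=
      lt_of_le_of_ne (not_lt.1 hnot) fun h => hne' (π.symm.injective h).symm
    rcases lt_or_gt_of_ne hne' with hlt | hlt
    · have h := (hsub (show (σ i, σ j) ∈ inversions π from ⟨hlt, hji⟩)).2
      simp only [Precedes, Equiv.symm_apply_apply, Fin.lt_def] at h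
      omega
    · refine hno _ ⟨i, j, hij, hlt, rfl⟩ ?_
      rintro ⟨a, b⟩ hab
      refine ⟨hab.1, ?_⟩
      have h := (hsub hab).2
      change Equiv.swap i j (σ.symm b) < Equiv.swap i j (σ.symm a)
      refine (swap_adjacent_lt_iff hij _ _).2 (Or.inl ⟨h, ?_⟩)
      simp only [Equiv.symm_apply_eq]
      rintro ⟨rfl, rfl⟩
      exact hnot hab.2
  exact inv_mul_eq_one.1 hone

theorem weakBruhatLe_iff_inversions_subset {n : ℕ} {π σ : Equiv.Perm (Fin n)} :
    WeakBruhatLe π σ ↔ inversions π ⊆ inversions σ := by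
  constructor
  · intro h
    induction h with
    | refl => exact subset_rfl
    | tail _ hstep ih => exact (inversions_ssubset_of_simpleRedStep hstep).1.trans ih
  · induction hS : inversions σ using WellFoundedLT.induction generalizing σ with
    | ind S ih =>
      subst hS
      intro hsub
      by_cases hne : π = σ
      · exact hne ▸ Relation.ReflTransGen.refl
      · obtain ⟨τ, hstep, hτ⟩ := exists_simpleRedStep hsub hne
        exact Relation.ReflTransGen.head hstep
          (ih _ (inversions_ssubset_of_simpleRedStep hstep) rfl hτ)

theorem precRel_iff_of_lt {n : ℕ} {R : Fin n → Fin n → Prop} (hR : PLSPIO R) {a b : Fin n}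
    (hab : a < b) : precRel R a b ↔ R a b := by
  obtain ⟨⟨hirr, htrans, -⟩, hlt, hZ⟩ := hR
  constructor
  · rintro (h | h)
    · by_contra hnot
      obtain ⟨z, hz, hbz⟩ := Set.exists_of_ssubset h
      refine (hZ b a ⟨⟨fun h => (hlt _ _ h).asymm hab, hnot⟩, z, Or.inr hz, ?_, hbz⟩).asymm hab
      exact fun hzb => hnot (htrans _ _ _ hz hzb)
    · exact absurd hab h.2.asymm
  · exact fun h => Or.inl ⟨fun z hz => htrans _ _ _ h hz, fun hsub => hirr b (hsub h)⟩

theorem mem_inversions_iff {n : ℕ} {R : Fin n → Fin n → Prop} (hR : PLSPIO R)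
    {π : Equiv.Perm (Fin n)} (hπ : IsPiOf R π) (a b : Fin n) :
    (a, b) ∈ inversions π ↔ a < b ∧ ¬ R a b := by
  refine and_congr_right fun hab => ?_
  rw [← precRel_iff_of_lt hR hab, ← hπ a b hab.ne]
  simp only [Precedes, not_lt]
  exact ⟨le_of_lt, fun h => lt_of_le_of_ne h (π.symm.injective.ne hab.ne')⟩

/-- The Tamari order is isomorphic to the weak Bruhat order on `Av_n(312)`:
`π(R1) ≤_b π(R2)` iff `R1 ≤_T R2`. -/
theorem tamari_iso_weakBruhat {n : ℕ} (R1 R2 : Fin n → Fin n → Prop)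
    (h1 : PLSPIO R1) (h2 : PLSPIO R2)
    (π1 π2 : Equiv.Perm (Fin n)) (hp1 : IsPiOf R1 π1) (hp2 : IsPiOf R2 π2) :
    WeakBruhatLe π1 π2 ↔ ∀ k, filt R2 k ⊆ filt R1 k := by
  rw [weakBruhatLe_iff_inversions_subset]
  constructor
  · intro hsub k y hy
    by_contra hnot
    have hmem := (mem_inversions_iff h1 hp1 k y).2 ⟨h2.2.1 _ _ hy, hnot⟩
    exact ((mem_inversions_iff h2 hp2 k y).1 (hsub hmem)).2 hy
  · rintro hfilt ⟨a, b⟩ hab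
    obtain ⟨hlt, hnot⟩ := (mem_inversions_iff h1 hp1 a b).1 hab
    exact (mem_inversions_iff h2 hp2 a b).2 ⟨hlt, fun h => hnot (hfilt a h)⟩
end

section
/- Let π be a 312-avoiding permutation of {1,...,n} and let m ∈ {1,...,n-1}. Then m precedes m+1 in π (i.e. m is a consecutive noninversion of π) if and only if |i_π(m)| ≠ |i_π(m+1)|. -/
/-- `m` is a consecutive noninversion of `π`: `m` is the largest value, or `m`
precedes `m+1` in `π`. -/
def CNI {n : ℕ} (π : Equiv.Perm (Fin n)) (m : Fin n) : Prop :=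
  (m : ℕ) + 1 = n ∨ ∃ m' : Fin n, (m' : ℕ) = (m : ℕ) + 1 ∧ Precedes π m m'

/-- `max_π(k)`: the maximum of the first entries of `π`, up to position `k`. -/
def maxVec {n : ℕ} (π : Equiv.Perm (Fin n)) (k : Fin n) : Fin n :=
  ((Finset.Iic k).image π).max' (Finset.nonempty_Iic.image π)

/-- If `m` precedes `m + 1`, then `i_π(m)` is strictly contained in `i_π(m + 1)`. -/
theorem iset_ssubset_of_precedes {n : ℕ} (π : Equiv.Perm (Fin n)) {m m' : Fin n}
    (hlt : m < m') (hp : Precedes π m m') : iset π m ⊂ iset π m' := by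
  refine (Set.ssubset_iff_of_subset ?_).2 ⟨m, ⟨hlt, hp⟩, fun hmem => lt_irrefl m hmem.1⟩
  exact fun x hx => ⟨hx.1.trans hlt, lt_trans hx.2 hp⟩

/-- If `π` avoids 312 and `m + 1` precedes `m`, then `i_π(m) = i_π(m + 1)`. -/
theorem iset_eq_of_precedes {n : ℕ} (π : Equiv.Perm (Fin n)) (h : Avoids312 π)
    {m m' : Fin n} (hm : (m' : ℕ) = (m : ℕ) + 1) (hp : Precedes π m' m) :
    iset π m = iset π m' := by
  have hlt : m < m' := by omega
  ext x
  constructor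
  · rintro ⟨hxm, hx⟩
    refine ⟨hxm.trans hlt, ?_⟩
    by_contra hnot
    have hne : π.symm m' ≠ π.symm x := fun e => (hxm.trans hlt).ne' (π.symm.injective e)
    exact h ⟨π.symm m', π.symm x, π.symm m, lt_of_le_of_ne (not_lt.1 hnot) hne, hx,
      by simpa using hxm, by simpa using hlt⟩
  · rintro ⟨hxm, hx⟩
    have hxp : Precedes π x m := lt_trans hx hp
    have hne : x ≠ m := fun e => lt_irrefl _ (e ▸ hxp)
    exact ⟨by omega, hxp⟩

/-- For a 312-avoiding permutation `π` and `m ∈ {1,...,n-1}`, `m` precedes `m+1` in `π`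
iff `|i_π(m)| ≠ |i_π(m+1)|`. -/
theorem cni_iff_iset_card_ne {n : ℕ} (π : Equiv.Perm (Fin n)) (h : Avoids312 π)
    (m m' : Fin n) (hm : (m' : ℕ) = (m : ℕ) + 1) :
    Precedes π m m' ↔ (iset π m).ncard ≠ (iset π m').ncard := by
  have hlt : m < m' := by omega
  constructor
  · intro hp
    exact (Set.ncard_lt_ncard (iset_ssubset_of_precedes π hlt hp)).ne
  · intro hne
    by_contra hnot
    have hsymm : π.symm m' ≠ π.symm m := fun e => hlt.ne' (π.symm.injective e)
    have hp : Precedes π m' m := lt_of_le_of_ne (not_lt.1 hnot) hsymm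
    exact hne (congrArg Set.ncard (iset_eq_of_precedes π h hm hp))
end

section
/- Let π be a 312-avoiding permutation of {1,...,n}. Then for all j, k ∈ {1,...,n}, j < k implies |i_π(j)| ≤ |i_π(k)|. -/
/-- For a 312-avoiding permutation `π`, `j < k` implies `i_π(j) ⊆ i_π(k)`. -/
theorem iset_subset_iset {n : ℕ} (π : Equiv.Perm (Fin n)) (h : Avoids312 π)
    {j k : Fin n} (hjk : j < k) : iset π j ⊆ iset π k := by
  rintro m ⟨hmj, hpm⟩
  refine ⟨hmj.trans hjk, ?_⟩
  by_contra hmk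
  have hne : π.symm k ≠ π.symm m := fun e =>
    (hmj.trans hjk).ne' (π.symm.injective e)
  have hkm : π.symm k < π.symm m := lt_of_le_of_ne (not_lt.mp hmk) hne
  exact h ⟨π.symm k, π.symm m, π.symm j, hkm, hpm, by simpa using hmj, by simpa using hjk⟩

/-- For a 312-avoiding permutation `π`, `j < k` implies `|i_π(j)| ≤ |i_π(k)|`. -/
theorem iset_card_monotone {n : ℕ} (π : Equiv.Perm (Fin n)) (h : Avoids312 π)
    (j k : Fin n) (hjk : j < k) :
    (iset π j).ncard ≤ (iset π k).ncard := by
  exact Set.ncard_le_ncard (iset_subset_iset π h hjk) (Set.toFinite _)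
end

section
/- Let π be a 312-avoiding permutation of {1,...,n} and let m be a consecutive noninversion of π. Then π(|i_π(m)| + 1) = m; equivalently, the position of m in π is π⁻¹(m) = |i_π(m)| + 1. -/
/-- In a 312-avoiding permutation, every value preceding a consecutive noninversion `m` is
less than `m`. -/
theorem Precedes.lt_of_cni {n : ℕ} {π : Equiv.Perm (Fin n)} (h : Avoids312 π) {m x : Fin n}
    (hm : CNI π m) (hx : Precedes π x m) : x < m := by
  by_contra! hle
  have hne : m ≠ x := by
    rintro rfl
    exact lt_irrefl _ hx
  have hlt : (m : ℕ) < x := Fin.lt_def.mp (lt_of_le_of_ne hle hne)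
  rcases hm with hmax | ⟨m', hm', hmm'⟩
  · omega
  · have hxm' : m' ≠ x := by
      rintro rfl
      exact lt_asymm hx hmm'
    have hval : (m' : ℕ) ≠ x := Fin.val_ne_of_ne hxm'
    refine h ⟨π.symm x, π.symm m, π.symm m', hx, hmm', ?_, ?_⟩ <;>
      simp only [Equiv.apply_symm_apply, Fin.lt_def] <;> omega

/-- In a 312-avoiding permutation, the set `i_π(m)` of a consecutive noninversion `m` consists of
all entries before `m`. -/
theorem iset_eq_image_Iio {n : ℕ} {π : Equiv.Perm (Fin n)} (h : Avoids312 π) {m : Fin n}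
    (hm : CNI π m) : iset π m = π '' Set.Iio (π.symm m) := by
  ext x
  rw [Equiv.image_eq_preimage_symm]
  exact ⟨fun hx => hx.2, fun hx => ⟨Precedes.lt_of_cni h hm hx, hx⟩⟩

/-- For a 312-avoiding permutation `π` and a consecutive noninversion `m` of `π`, the
position of `m` in `π` is `|i_π(m)| + 1` (with positions counted from 1, i.e. the
0-based index of `m` equals `|i_π(m)|`). -/
theorem cni_position_eq_iset_card {n : ℕ} (π : Equiv.Perm (Fin n)) (h : Avoids312 π)
    (m : Fin n) (hm : CNI π m) :
    (π.symm m : ℕ) = (iset π m).ncard := by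
  rw [iset_eq_image_Iio h hm, Set.ncard_image_of_injective _ π.injective, Set.ncard_eq_toFinset_card']
  simp
end

section
/- Let π be a 312-avoiding permutation of {1,...,n}. Then m ∈ {1,...,n} is a consecutive noninversion of π if and only if every entry of π preceding m is less than m, i.e. for every j ∈ {1,...,n}, if j precedes m in π then j < m. -/
/-- For a 312-avoiding permutation `π`, `m` is a consecutive noninversion of `π` iff
every entry of `π` preceding `m` is less than `m`. -/
theorem cni_iff_preceded_only_by_lesser {n : ℕ} (π : Equiv.Perm (Fin n))
    (h : Avoids312 π) (m : Fin n) :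
    CNI π m ↔ ∀ j : Fin n, Precedes π j m → j < m := by
  unfold CNI Precedes
  constructor
  · intro hm j hj
    by_contra hle
    have hne : j ≠ m := by
      rintro rfl
      exact lt_irrefl _ hj
    have hlt : m < j := lt_of_le_of_ne (not_lt.mp hle) hne.symm
    rcases hm with hm | ⟨m', hm', hmm'⟩
    · omega
    · have hne' : m' ≠ j := by
        rintro rfl
        exact lt_asymm hj hmm'
      have hlt' : m' < j := lt_of_le_of_ne (by omega) hne'
      refine h ⟨π.symm j, π.symm m, π.symm m', hj, hmm', ?_, ?_⟩
      · simp only [Equiv.apply_symm_apply]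
        omega
      · simpa only [Equiv.apply_symm_apply] using hlt'
  · intro hall
    by_cases hm : (m : ℕ) + 1 = n
    · exact Or.inl hm
    · refine Or.inr ⟨⟨m + 1, by omega⟩, rfl, ?_⟩
      by_contra hle
      have hne : π.symm ⟨m + 1, by omega⟩ ≠ π.symm m := by
        simp [Fin.ext_iff]
      have hlt := hall _ (lt_of_le_of_ne (not_lt.mp hle) hne)
      simp [Fin.lt_def] at hlt
end

section
/- Let π be a 312-avoiding permutation of {1,...,n}. Then the set of consecutive noninversions of π coincides with the set of values taken by the vector max_π, i.e. {m : m is a consecutive noninversion of π} = {max_π(k) : 1 ≤ k ≤ n}; moreover, for every consecutive noninversion m of π, the position of m in π equals the index of the first occurrence of m in max_π, i.e. π⁻¹(m) = min{k : max_π(k) = m}. -/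
theorem maxVec_eq_iff {n : ℕ} (π : Equiv.Perm (Fin n)) (k v : Fin n) :
    maxVec π k = v ↔ π.symm v ≤ k ∧ ∀ j ≤ k, π j ≤ v := by
  rw [maxVec, Finset.max'_eq_iff]
  constructor
  · rintro ⟨hv, hmax⟩
    obtain ⟨i, hi, rfl⟩ := Finset.mem_image.mp hv
    exact ⟨by simpa using hi,
      fun j hj => hmax _ (Finset.mem_image_of_mem π (Finset.mem_Iic.mpr hj))⟩
  · rintro ⟨hv, hmax⟩
    refine ⟨Finset.mem_image.mpr ⟨π.symm v, Finset.mem_Iic.mpr hv, π.apply_symm_apply v⟩, ?_⟩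
    intro b hb
    obtain ⟨j, hj, rfl⟩ := Finset.mem_image.mp hb
    exact hmax j (Finset.mem_Iic.mp hj)

/-- In a 312-avoiding permutation, a consecutive noninversion is a left-to-right maximum. -/
theorem CNI.apply_le {n : ℕ} {π : Equiv.Perm (Fin n)} (h : Avoids312 π) {m : Fin n}
    (hm : CNI π m) {j : Fin n} (hj : j ≤ π.symm m) : π j ≤ m := by
  by_contra! hlt
  rcases hm with hn | ⟨m', hm', hprec⟩
  · omega
  · have hne : π j ≠ m' := by
      rintro rfl
      rw [Precedes, π.symm_apply_apply] at hprec
      exact absurd hprec hj.not_gt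
    have hj' : j ≠ π.symm m := by
      rintro rfl
      simp at hlt
    refine h ⟨j, π.symm m, π.symm m', lt_of_le_of_ne hj hj', hprec, ?_, ?_⟩ <;>
      simp only [Equiv.apply_symm_apply] <;> omega

/-- Every value of the vector `max_π` is a consecutive noninversion. -/
theorem cni_maxVec {n : ℕ} (π : Equiv.Perm (Fin n)) (k : Fin n) : CNI π (maxVec π k) := by
  obtain ⟨hk, hmax⟩ := (maxVec_eq_iff π k _).mp rfl
  by_cases hn : (maxVec π k : ℕ) + 1 = n
  · exact Or.inl hn
  · refine Or.inr ⟨⟨maxVec π k + 1, by omega⟩, rfl, ?_⟩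
    refine hk.trans_lt (not_le.mp fun hle => ?_)
    have := hmax _ hle
    rw [π.apply_symm_apply, Fin.le_def] at this
    simp at this

/-- For a 312-avoiding permutation `π`, the consecutive noninversions of `π` are exactly
the values of the vector `max_π`; moreover, for each consecutive noninversion `m`, the
position of `m` in `π` is the index of the first occurrence of `m` in `max_π`. -/
theorem cni_eq_maxVec_values {n : ℕ} (π : Equiv.Perm (Fin n)) (h : Avoids312 π) :
    {m | CNI π m} = {v | ∃ k, maxVec π k = v} ∧
    ∀ m : Fin n, CNI π m → IsLeast {k | maxVec π k = m} (π.symm m) := by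
  have hleast (m : Fin n) (hm : CNI π m) : IsLeast {k | maxVec π k = m} (π.symm m) :=
    ⟨(maxVec_eq_iff π _ m).mpr ⟨le_rfl, fun _ => hm.apply_le h⟩,
      fun k hk => ((maxVec_eq_iff π k m).mp hk).1⟩
  refine ⟨Set.ext fun m => ⟨fun hm => ⟨_, (hleast m hm).1⟩, ?_⟩, hleast⟩
  rintro ⟨k, rfl⟩
  exact cni_maxVec π k
end

section
/- Let π1 and π2 be two 312-avoiding permutations of {1,...,n}. Then the following are equivalent: (a) for every k ∈ {1,...,n}, |i_{π1}(k)| ≥ |i_{π2}(k)|; (b) for every k ∈ {1,...,n}, max_{π1}(k) ≤ max_{π2}(k). -/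
theorem maxVec_lt_iff {n : ℕ} (π : Equiv.Perm (Fin n)) (j k : Fin n) :
    maxVec π j < k ↔ ∀ i ≤ j, π i < k := by
  simp [maxVec, Finset.max'_lt_iff]

theorem maxVec_mono {n : ℕ} (π : Equiv.Perm (Fin n)) : Monotone (maxVec π) := fun _ _ h =>
  Finset.max'_subset _ (Finset.image_subset_image (Finset.Iic_subset_Iic.2 h))

/-- In a 312-avoiding permutation, the smaller values preceding `k` are exactly the entries
before the first entry that is at least `k`. -/
theorem iset_eq_image {n : ℕ} {π : Equiv.Perm (Fin n)} (h : Avoids312 π) (k : Fin n) :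
    iset π k = π '' {j | maxVec π j < k} := by
  ext m
  rw [Equiv.image_eq_preimage_symm]
  simp only [iset, Precedes, Set.mem_ofPred_eq, Set.mem_preimage, maxVec_lt_iff]
  constructor
  · rintro ⟨hmk, hpos⟩ i hi
    by_contra! hki
    have hne : i ≠ π.symm m := by
      rintro rfl
      rw [Equiv.apply_symm_apply] at hki
      exact hki.not_gt hmk
    have hne' : k ≠ π i := by
      rintro rfl
      rw [Equiv.symm_apply_apply] at hpos
      exact hi.not_gt hpos
    exact h ⟨i, π.symm m, π.symm k, lt_of_le_of_ne hi hne, hpos, by simpa using hmk,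
      by simpa using lt_of_le_of_ne hki hne'⟩
  · intro hlt
    refine ⟨by simpa using hlt _ le_rfl, ?_⟩
    by_contra! hle
    simpa using hlt _ hle

theorem ncard_iset {n : ℕ} {π : Equiv.Perm (Fin n)} (h : Avoids312 π) (k : Fin n) :
    (iset π k).ncard = {j | maxVec π j < k}.ncard := by
  rw [iset_eq_image h, Set.ncard_image_of_injective _ π.injective]

theorem isLowerSet_maxVec_lt {n : ℕ} (π : Equiv.Perm (Fin n)) (k : Fin n) :
    IsLowerSet {j | maxVec π j < k} := fun _ _ hab ha =>
  (maxVec_mono π hab).trans_lt ha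

/-- For two 312-avoiding permutations `π1, π2` of `{1,...,n}`, we have
`|i_{π1}(k)| ≥ |i_{π2}(k)|` for all `k` iff `max_{π1}(k) ≤ max_{π2}(k)` for all `k`. -/
theorem iset_card_ge_iff_maxVec_le {n : ℕ} (π1 π2 : Equiv.Perm (Fin n))
    (h1 : Avoids312 π1) (h2 : Avoids312 π2) :
    (∀ k, (iset π2 k).ncard ≤ (iset π1 k).ncard) ↔ (∀ k, maxVec π1 k ≤ maxVec π2 k) := by
  simp only [ncard_iset h1, ncard_iset h2]
  constructor
  · intro h j
    by_contra! hlt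
    have hsub : {i | maxVec π2 i < maxVec π1 j} ⊆ {i | maxVec π1 i < maxVec π1 j} := by
      rcases (isLowerSet_maxVec_lt π2 (maxVec π1 j)).total
        (isLowerSet_maxVec_lt π1 (maxVec π1 j)) with hs | hs
      · exact hs
      · exact (Set.eq_of_subset_of_ncard_le hs (h _)).ge
    exact lt_irrefl (maxVec π1 j) (Set.mem_ofPred_eq.mp (hsub hlt))
  · exact fun h k => Set.ncard_le_ncard fun j hj => (h j).trans_lt hj
end

section
/- The Dyck order is isomorphic to the strong Bruhat order restricted to Av_n(312): for any two preorder-labelled series parallel interval orders R1, R2 on {1,...,n}, one has π(R1) ≤_B π(R2) in the strong Bruhat order if and only if R1 ≤_D R2 in the Dyck order (i.e. |R1⁻¹(k)| ≥ |R2⁻¹(k)| for every k). -/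
/-- One permutation is a reduction of another: it is obtained by interchanging two
entries in positions `i < j` with `π(i) > π(j)`. -/
def RedStep {n : ℕ} (σ τ : Equiv.Perm (Fin n)) : Prop :=
  ∃ i j : Fin n, i < j ∧ σ j < σ i ∧ τ = σ * Equiv.swap i j

/-- The strong Bruhat order: `π1 ≤_B π2` iff `π1` is obtained from `π2` by a finite
sequence of reductions. -/
def BruhatLe {n : ℕ} (π1 π2 : Equiv.Perm (Fin n)) : Prop :=
  Relation.ReflTransGen RedStep π2 π1

/-- `x R y` holds exactly when the pair `x, y` is not an inversion of `π(R)`. -/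
theorem rel_iff_noninversion {n : ℕ} {R : Fin n → Fin n → Prop} (h : PLSPIO R)
    {π : Equiv.Perm (Fin n)} (hp : IsPiOf R π) (x y : Fin n) :
    R x y ↔ x < y ∧ π.symm x < π.symm y := by
  obtain ⟨⟨hirr, htrans, -, -⟩, hlt, hZ⟩ := h
  constructor
  · intro hxy
    refine ⟨hlt _ _ hxy, (hp x y (hlt _ _ hxy).ne).2 (Or.inl ⟨fun z hz => htrans _ _ _ hxy hz, ?_⟩)⟩
    exact fun hsub => hirr y (hsub hxy)
  · rintro ⟨hxy, hpos⟩
    rcases (hp x y hxy.ne).1 hpos with ⟨-, hns⟩ | ⟨-, hyx⟩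
    · by_contra hR
      obtain ⟨z, hxz, hyz⟩ := Set.not_subset.1 hns
      have hyx : ¬ R y x := fun h' => (hlt _ _ h').not_gt hxy
      exact (hZ y x ⟨⟨hyx, hR⟩, z, Or.inr hxz, fun hzy => hR (htrans _ _ _ hxz hzy), hyz⟩).not_gt hxy
    · exact absurd hyx hxy.not_gt

/-- The permutation of a preorder-labelled series parallel interval order avoids 312. -/
theorem avoids312_of_isPiOf {n : ℕ} {R : Fin n → Fin n → Prop} (h : PLSPIO R)
    {π : Equiv.Perm (Fin n)} (hp : IsPiOf R π) : Avoids312 π := by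
  rintro ⟨i, j, k, hij, hjk, h1, h2⟩
  have key := rel_iff_noninversion h hp
  refine (h.2.2 (π i) (π j) ⟨⟨?_, ?_⟩, π k, Or.inr ?_, ?_, ?_⟩).not_gt (h1.trans h2) <;>
    simp only [key, Equiv.symm_apply_apply] <;> grind

/-- The positions all of whose weak predecessors carry entries of `π` smaller than `k`. -/
def initialBelow {n : ℕ} (π : Equiv.Perm (Fin n)) (k : Fin n) : Set (Fin n) :=
  {i | ∀ j ≤ i, π j < k}

theorem isLowerSet_initialBelow {n : ℕ} (π : Equiv.Perm (Fin n)) (k : Fin n) :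
    IsLowerSet (initialBelow π k) :=
  fun _ _ hba ha j hj => ha j (hj.trans hba)

theorem idl_eq_image_initialBelow {n : ℕ} {R : Fin n → Fin n → Prop} (h : PLSPIO R)
    {π : Equiv.Perm (Fin n)} (hp : IsPiOf R π) (k : Fin n) :
    idl R k = π '' initialBelow π k := by
  ext x
  obtain ⟨i, rfl⟩ := π.surjective x
  obtain ⟨l, rfl⟩ := π.surjective k
  rw [π.injective.mem_set_image]
  change R _ _ ↔ ∀ j ≤ i, π j < π l
  rw [rel_iff_noninversion h hp, Equiv.symm_apply_apply, Equiv.symm_apply_apply]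
  constructor
  · rintro ⟨hx, hil⟩ j hj
    by_contra! hlj
    have hlj' : π l < π j := hlj.lt_of_ne fun e => (hj.trans_lt hil).ne' (π.injective e)
    have hji : j < i := hj.lt_of_ne (by rintro rfl; exact hx.not_ge hlj)
    exact avoids312_of_isPiOf h hp ⟨j, i, l, hji, hil, hx, hlj'⟩
  · intro hi
    exact ⟨hi i le_rfl, lt_of_not_ge fun hli => (hi l hli).false⟩

theorem ncard_idl {n : ℕ} {R : Fin n → Fin n → Prop} (h : PLSPIO R)
    {π : Equiv.Perm (Fin n)} (hp : IsPiOf R π) (k : Fin n) :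
    (idl R k).ncard = (initialBelow π k).ncard := by
  rw [idl_eq_image_initialBelow h hp, Set.ncard_image_of_injective _ π.injective]

theorem IsLowerSet.ncard_le_ncard_iff {α : Type*} [LinearOrder α] [Finite α] {s t : Set α}
    (hs : IsLowerSet s) (ht : IsLowerSet t) : s.ncard ≤ t.ncard ↔ s ⊆ t := by
  refine ⟨fun hle => ?_, fun hst => Set.ncard_le_ncard hst⟩
  rcases hs.total ht with hst | hts
  · exact hst
  · exact (Set.eq_of_subset_of_ncard_le hts hle).ge

/-- Every prefix maximum of `σ` is at most the corresponding prefix maximum of `τ`. -/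
def PrefixMaxLe {n : ℕ} (σ τ : Equiv.Perm (Fin n)) : Prop :=
  ∀ i, ∃ j ≤ i, σ i ≤ τ j

theorem prefixMaxLe_iff_initialBelow_subset {n : ℕ} {σ τ : Equiv.Perm (Fin n)} :
    PrefixMaxLe σ τ ↔ ∀ k, initialBelow τ k ⊆ initialBelow σ k := by
  constructor
  · intro h k i hi j hj
    obtain ⟨l, hl, hle⟩ := h j
    exact hle.trans_lt (hi l (hl.trans hj))
  · intro h i
    by_contra! hc
    exact (h (σ i) hc i le_rfl).false

theorem BruhatLe.prefixMaxLe {n : ℕ} {σ τ : Equiv.Perm (Fin n)} (h : BruhatLe σ τ) :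
    PrefixMaxLe σ τ := by
  induction h with
  | refl => exact fun i => ⟨i, le_rfl, le_rfl⟩
  | @tail ρ σ _ hstep ih =>
    intro x
    obtain ⟨i, j, hij, hlt, rfl⟩ := hstep
    have hx : ∃ y ≤ x, (ρ * Equiv.swap i j) x ≤ ρ y := by
      rw [Equiv.Perm.mul_apply]
      rcases eq_or_ne x i with rfl | hxi
      · exact ⟨x, le_rfl, by simpa using hlt.le⟩
      · rcases eq_or_ne x j with rfl | hxj
        · exact ⟨i, hij.le, by simp⟩
        · exact ⟨x, le_rfl, by rw [Equiv.swap_apply_of_ne_of_ne hxi hxj]⟩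
    obtain ⟨y, hy, hle⟩ := hx
    obtain ⟨z, hz, hle'⟩ := ih y
    exact ⟨z, hz.trans hy, hle.trans hle'⟩

/-- Among the permutations with smaller prefix maxima, a 312-avoiding one is greedy. -/
theorem PrefixMaxLe.apply_le_of_eqOn {n : ℕ} {σ τ : Equiv.Perm (Fin n)} (hτ : Avoids312 τ)
    (h : PrefixMaxLe σ τ) {i : Fin n} (hi : ∀ j < i, σ j = τ j) : σ i ≤ τ i := by
  by_contra! hlt
  obtain ⟨j, hj, hle⟩ := h i
  have hji : j < i := hj.lt_of_ne (by rintro rfl; exact hle.not_gt hlt)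
  have hlt' : σ i < τ j :=
    hle.lt_of_ne fun e => hji.ne' (σ.injective (e.trans (hi j hji).symm))
  obtain ⟨k, hk⟩ := τ.surjective (σ i)
  have hik : i < k := by
    rcases lt_trichotomy k i with hki | rfl | hik
    · exact absurd (σ.injective ((hi k hki).trans hk)) hki.ne
    · exact absurd hk hlt.ne
    · exact hik
  exact hτ ⟨j, i, k, hji, hik, hk ▸ hlt, hk ▸ hlt'⟩

/-- Raising the entry in position `i` to the entry `τ i` keeps the prefix maxima below `τ`. -/
theorem PrefixMaxLe.mul_swap {n : ℕ} {σ τ : Equiv.Perm (Fin n)} (h : PrefixMaxLe σ τ)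
    {i j : Fin n} (hij : i < j) (hj : σ j = τ i) (hlt : σ i < σ j) :
    PrefixMaxLe (σ * Equiv.swap i j) τ := by
  intro x
  rw [Equiv.Perm.mul_apply]
  rcases eq_or_ne x i with rfl | hxi
  · exact ⟨x, le_rfl, by simp [hj]⟩
  · rcases eq_or_ne x j with rfl | hxj
    · exact ⟨i, hij.le, by simpa [← hj] using hlt.le⟩
    · rw [Equiv.swap_apply_of_ne_of_ne hxi hxj]
      exact h x

theorem bruhatLe_of_prefixMaxLe_of_eqOn {n : ℕ} {τ : Equiv.Perm (Fin n)} (hτ : Avoids312 τ)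
    (d m : ℕ) (hn : n ≤ m + d) (σ : Equiv.Perm (Fin n)) (h : PrefixMaxLe σ τ)
    (heq : ∀ i : Fin n, i.val < m → σ i = τ i) : BruhatLe σ τ := by
  induction d generalizing m σ with
  | zero =>
    obtain rfl : σ = τ := Equiv.ext fun i => heq i (by lia)
    exact Relation.ReflTransGen.refl
  | succ d ih =>
    by_cases hm : ∀ i : Fin n, i.val = m → σ i = τ i
    · exact ih (m + 1) (by lia) σ h fun i hi => (Nat.lt_succ_iff_lt_or_eq.1 hi).elim (heq i) (hm i)
    push Not at hm
    obtain ⟨i, rfl, hne⟩ := hm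
    obtain ⟨j, hj⟩ := σ.surjective (τ i)
    have hlt : σ i < σ j :=
      hj ▸ (h.apply_le_of_eqOn hτ fun j hj => heq j hj).lt_of_ne hne
    have hij : i < j := by
      rcases lt_trichotomy j i with hji | rfl | hij
      · exact absurd (τ.injective ((heq j hji).symm.trans hj)) hji.ne
      · exact absurd hj hne
      · exact hij
    have hle : BruhatLe (σ * Equiv.swap i j) τ := by
      refine ih (i.val + 1) (by lia) _ (h.mul_swap hij hj hlt) fun x hx => ?_
      rw [Equiv.Perm.mul_apply]
      rcases eq_or_ne x i with rfl | hxi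
      · simpa using hj
      · have hxlt : x < i := (Fin.le_def.2 (Nat.lt_succ_iff.1 hx)).lt_of_ne hxi
        rw [Equiv.swap_apply_of_ne_of_ne hxi (hxlt.trans hij).ne]
        exact heq x hxlt
    refine hle.tail ⟨i, j, hij, by simpa using hlt, ?_⟩
    rw [mul_assoc, Equiv.swap_mul_self, mul_one]

/-- Below a 312-avoiding permutation, the strong Bruhat order compares prefix maxima. -/
theorem bruhatLe_iff_prefixMaxLe {n : ℕ} {σ τ : Equiv.Perm (Fin n)} (hτ : Avoids312 τ) :
    BruhatLe σ τ ↔ PrefixMaxLe σ τ :=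
  ⟨BruhatLe.prefixMaxLe, fun h =>
    bruhatLe_of_prefixMaxLe_of_eqOn hτ n 0 (by lia) σ h fun _ hi => absurd hi (Nat.not_lt_zero _)⟩

/-- The Dyck order is isomorphic to the strong Bruhat order on `Av_n(312)`:
`π(R1) ≤_B π(R2)` iff `R1 ≤_D R2`. -/
theorem dyck_iso_strongBruhat {n : ℕ} (R1 R2 : Fin n → Fin n → Prop)
    (h1 : PLSPIO R1) (h2 : PLSPIO R2)
    (π1 π2 : Equiv.Perm (Fin n)) (hp1 : IsPiOf R1 π1) (hp2 : IsPiOf R2 π2) :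
    BruhatLe π1 π2 ↔ ∀ k, (idl R2 k).ncard ≤ (idl R1 k).ncard := by
  rw [bruhatLe_iff_prefixMaxLe (avoids312_of_isPiOf h2 hp2), prefixMaxLe_iff_initialBelow_subset]
  refine forall_congr' fun k => ?_
  rw [ncard_idl h1 hp1, ncard_idl h2 hp2,
    (isLowerSet_initialBelow π2 k).ncard_le_ncard_iff (isLowerSet_initialBelow π1 k)]
end
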